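/- arXiv:2302.00736 — 3 statements merged into one kernel-verified Lean document; each statement's English description precedes it below -/
import Mathlib

section
/- Let n ≥ 1, N = {1,…,n}, and i ∈ N. For the distributions P⁺(S) = 1/(|S|·C(n,|S|)·Hₙ) on nonempty S ⊆ N and P⁻(S) = 1/((n−|S|)·C(n,|S|)·Hₙ) on proper S ⊊ N, it holds that ∑_{S ⊆ N, i ∈ S} P⁺(S) = 1/Hₙ and ∑_{S ⊊ N, i ∉ S} P⁻(S) = 1/Hₙ; i.e., a random coalition A⁺ ∼ P⁺ contains i with probability 1/Hₙ, and a random coalition A⁻ ∼ P⁻ excludes i with probability 1/Hₙ. -/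
open Finset

/-- The `n`-th harmonic number `Hₙ = ∑_{k=1}^n 1/k`. -/
noncomputable def harm (n : ℕ) : ℝ := ∑ k ∈ Finset.range n, (1 : ℝ) / (k + 1)

/-- The weights `1 / ((n - |S|) * C(n, |S|))` of the subsets that avoid a fixed point sum to `1`. -/
theorem sum_filter_notMem_one_div_sub_card_mul_choose (n : ℕ) (i : Fin n) :
    ∑ S ∈ (Finset.univ : Finset (Finset (Fin n))).filter (fun S => i ∉ S),
      (1 : ℝ) / (((n : ℝ) - (S.card : ℝ)) * (Nat.choose n S.card : ℝ)) = 1 := by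
  obtain _ | k := n
  · exact i.elim0
  have hfilter : (Finset.univ : Finset (Finset (Fin (k + 1)))).filter (fun S => i ∉ S) =
      (Finset.univ.erase i).powerset := by
    ext S
    simp [Finset.subset_erase]
  rw [hfilter, Finset.sum_powerset_apply_card
    (fun m => (1 : ℝ) / ((((k + 1 : ℕ) : ℝ) - (m : ℝ)) * (Nat.choose (k + 1) m : ℝ)))]
  have hcard : (Finset.univ.erase i).card = k := by simp
  rw [hcard]
  have hterm : ∀ m ∈ Finset.range (k + 1), k.choose m •
      ((1 : ℝ) / ((((k + 1 : ℕ) : ℝ) - (m : ℝ)) * (Nat.choose (k + 1) m : ℝ))) =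
        1 / ((k : ℝ) + 1) := by
    intro m hm
    have hlt : m < k + 1 := Finset.mem_range.mp hm
    have hchoose : (k.choose m : ℝ) * ((k : ℝ) + 1) =
        ((k + 1).choose m : ℝ) * (((k + 1 : ℕ) : ℝ) - m) := by
      rw [← Nat.cast_sub hlt.le]
      exact_mod_cast Nat.choose_mul_succ_eq k m
    have hpos : (0 : ℝ) < ((k + 1 : ℕ) : ℝ) - m := sub_pos.mpr (by exact_mod_cast hlt)
    have hcpos : (0 : ℝ) < ((k + 1).choose m : ℝ) := by
      exact_mod_cast Nat.choose_pos hlt.le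
    rw [nsmul_eq_mul, mul_one_div, div_eq_div_iff (by positivity) (by positivity), hchoose]
    ring
  rw [Finset.sum_congr rfl hterm, Finset.sum_const, Finset.card_range, nsmul_eq_mul]
  push_cast
  exact mul_one_div_cancel (by positivity)

/-- The weights `1 / (|S| * C(n, |S|))` of the subsets that contain a fixed point sum to `1`. -/
theorem sum_filter_mem_one_div_card_mul_choose (n : ℕ) (i : Fin n) :
    ∑ S ∈ (Finset.univ : Finset (Finset (Fin n))).filter (fun S => i ∈ S),
      (1 : ℝ) / ((S.card : ℝ) * (Nat.choose n S.card : ℝ)) = 1 := by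
  refine Eq.trans ?_ (sum_filter_notMem_one_div_sub_card_mul_choose n i)
  refine Finset.sum_nbij' (fun S => Sᶜ) (fun S => Sᶜ) (by simp) (by simp) (by simp) (by simp) ?_
  intro S _
  have hle : S.card ≤ n := by simpa using Finset.card_le_univ S
  rw [Finset.card_compl, Fintype.card_fin, Nat.choose_symm hle, Nat.cast_sub hle, sub_sub_cancel]

/-- A random coalition `A⁺ ∼ P⁺` contains a fixed player `i` with probability `1/Hₙ`,
and a random coalition `A⁻ ∼ P⁻` excludes `i` with probability `1/Hₙ`:
`∑_{S ⊆ N, i ∈ S} P⁺(S) = 1/Hₙ` and `∑_{S ⊊ N, i ∉ S} P⁻(S) = 1/Hₙ`. -/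
theorem stmt3 (n : ℕ) (hn : 1 ≤ n) (i : Fin n) :
    (∑ S ∈ (Finset.univ : Finset (Finset (Fin n))).filter (fun S => i ∈ S),
        (1 : ℝ) / ((S.card : ℝ) * (Nat.choose n S.card : ℝ) * harm n)) = 1 / harm n ∧
    (∑ S ∈ (Finset.univ : Finset (Finset (Fin n))).filter
        (fun S => S ≠ Finset.univ ∧ i ∉ S),
        (1 : ℝ) / (((n : ℝ) - (S.card : ℝ)) * (Nat.choose n S.card : ℝ) * harm n))
      = 1 / harm n := by
  constructor
  · simp_rw [← div_div _ _ (harm n)]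
    rw [← Finset.sum_div, sum_filter_mem_one_div_card_mul_choose]
  · have hfilter : (Finset.univ : Finset (Finset (Fin n))).filter
        (fun S => S ≠ Finset.univ ∧ i ∉ S) = Finset.univ.filter (fun S => i ∉ S) := by
      refine Finset.filter_congr fun S _ => and_iff_right_of_imp ?_
      rintro hi rfl
      exact hi (Finset.mem_univ i)
    simp_rw [← div_div _ _ (harm n)]
    rw [hfilter, ← Finset.sum_div, sum_filter_notMem_one_div_sub_card_mul_choose]
end

section
/- Let n ≥ 1, N = {1,…,n}, ν : 𝒫(N) → ℝ with ν(∅) = 0, and i ∈ N. Then Hₙ · ∑_{S ⊆ N, i ∈ S} P⁺(S)·ν(S) = φ_i⁺ and Hₙ · ∑_{S ⊊ N, i ∉ S} P⁻(S)·ν(S) = φ_i⁻; i.e., for A⁺ ∼ P⁺ and A⁻ ∼ P⁻, E[ν(A⁺) | i ∈ A⁺] = φ_i⁺ and E[ν(A⁻) | i ∉ A⁻] = φ_i⁻. -/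
open Finset

theorem harm_pos {n : ℕ} (hn : 1 ≤ n) : 0 < harm n :=
  Finset.sum_pos (fun _ _ => by positivity) ⟨0, Finset.mem_range.2 hn⟩

theorem cancel_mul_one_div_mul {h : ℝ} (hh : h ≠ 0) (a x : ℝ) :
    h * (1 / (a * h) * x) = 1 / a * x := by
  rw [one_div, mul_inv, one_div]
  field_simp

theorem succ_mul_choose_succ_eq_mul_choose_pred {n : ℕ} (hn : 1 ≤ n) (k : ℕ) :
    ((k + 1 : ℕ) : ℝ) * (n.choose (k + 1) : ℝ) = n * ((n - 1).choose k : ℝ) := by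
  obtain ⟨m, rfl⟩ := Nat.exists_eq_add_of_le' hn
  rw [mul_comm]
  exact_mod_cast (Nat.add_one_mul_choose_eq m k).symm

theorem sub_mul_choose_eq_mul_choose_pred {n k : ℕ} (hn : 1 ≤ n) (hk : k ≤ n) :
    ((n : ℝ) - k) * (n.choose k : ℝ) = n * ((n - 1).choose k : ℝ) := by
  obtain ⟨m, rfl⟩ := Nat.exists_eq_add_of_le' hn
  rw [← Nat.cast_sub hk, mul_comm, mul_comm ((m + 1 : ℕ) : ℝ)]
  exact_mod_cast (Nat.choose_mul_succ_eq m k).symm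

/-- `Hₙ · ∑_{S ⊆ N, i ∈ S} P⁺(S)·ν(S) = φ_i⁺` and
`Hₙ · ∑_{S ⊊ N, i ∉ S} P⁻(S)·ν(S) = φ_i⁻`, i.e. for `A⁺ ∼ P⁺` and `A⁻ ∼ P⁻`,
`E[ν(A⁺) | i ∈ A⁺] = φ_i⁺` and `E[ν(A⁻) | i ∉ A⁻] = φ_i⁻`. -/
theorem stmt5 (n : ℕ) (hn : 1 ≤ n) (ν : Finset (Fin n) → ℝ) (hν : ν ∅ = 0) (i : Fin n) :
    harm n * (∑ S ∈ (Finset.univ : Finset (Finset (Fin n))).filter (fun S => i ∈ S),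
        (1 : ℝ) / ((S.card : ℝ) * (Nat.choose n S.card : ℝ) * harm n) * ν S)
      = (∑ S ∈ (Finset.univ.erase i : Finset (Fin n)).powerset,
          (1 : ℝ) / ((n : ℝ) * (Nat.choose (n - 1) S.card : ℝ)) * ν (insert i S)) ∧
    harm n * (∑ S ∈ (Finset.univ : Finset (Finset (Fin n))).filter
        (fun S => S ≠ Finset.univ ∧ i ∉ S),
        (1 : ℝ) / (((n : ℝ) - (S.card : ℝ)) * (Nat.choose n S.card : ℝ) * harm n) * ν S)
      = (∑ S ∈ (Finset.univ.erase i : Finset (Fin n)).powerset,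
          (1 : ℝ) / ((n : ℝ) * (Nat.choose (n - 1) S.card : ℝ)) * ν S) := by
  have hH := (harm_pos hn).ne'
  have mem_iff (S : Finset (Fin n)) :
      S ∈ (Finset.univ.erase i : Finset (Fin n)).powerset ↔ i ∉ S := by
    simp [Finset.subset_erase]
  constructor
  · rw [Finset.mul_sum]
    symm
    refine Finset.sum_bij' (fun S _ => insert i S) (fun S _ => S.erase i) ?_ ?_ ?_ ?_ ?_
    · simp
    · simp [mem_iff]
    · intro S hS
      exact Finset.erase_insert ((mem_iff S).1 hS)
    · intro S hS
      exact Finset.insert_erase (Finset.mem_filter.1 hS).2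
    · intro S hS
      rw [cancel_mul_one_div_mul hH, Finset.card_insert_of_notMem ((mem_iff S).1 hS),
        succ_mul_choose_succ_eq_mul_choose_pred hn]
  · rw [Finset.mul_sum]
    refine Finset.sum_congr ?_ fun S _ => ?_
    · ext S
      rw [mem_iff, Finset.mem_filter]
      refine ⟨fun h => h.2.2, fun h => ⟨Finset.mem_univ S, ?_, h⟩⟩
      rintro rfl
      exact h (Finset.mem_univ i)
    · rw [cancel_mul_one_div_mul hH,
        sub_mul_choose_eq_mul_choose_pred hn (card_finset_fin_le S)]
end

section
/- Let X be a binomially distributed random variable with parameters m ≥ 1 and p ∈ (0,1]. Then E[1/(1+X)] = (1 − (1−p)^{m+1}) / ((m+1)·p), and in particular E[1/(1+X)] ≤ 1/(m·p). -/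
open Finset

/-- The expected reciprocal of one plus a binomial variable, with the denominators cleared. -/
theorem succ_mul_sum_binomial_mul_one_div {K : Type*} [Field K] [CharZero K] (m : ℕ) (p : K) :
    ((m : K) + 1) * p * ∑ k ∈ Finset.range (m + 1),
        (Nat.choose m k : K) * p ^ k * (1 - p) ^ (m - k) * (1 / (1 + (k : K)))
      = 1 - (1 - p) ^ (m + 1) := by
  have binomial_sum := add_pow p (1 - p) (m + 1)
  rw [add_sub_cancel, one_pow, Finset.sum_range_succ'] at binomial_sum
  simp only [Nat.add_sub_add_right, pow_zero, one_mul, Nat.sub_zero, Nat.choose_zero_right,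
    Nat.cast_one, mul_one] at binomial_sum
  rw [eq_sub_of_add_eq binomial_sum.symm |>.symm, Finset.mul_sum]
  refine Finset.sum_congr rfl fun k _ => ?_
  have hk : (1 + (k : K)) ≠ 0 := by
    rw [add_comm]
    exact Nat.cast_add_one_ne_zero k
  have choose_succ : ((m : K) + 1) * (m.choose k : K)
      = ((m + 1).choose (k + 1) : K) * (1 + (k : K)) := by
    rw [add_comm 1 (k : K)]
    exact_mod_cast Nat.add_one_mul_choose_eq m k
  field_simp
  linear_combination p ^ (k + 1) * (1 - p) ^ (m - k) * choose_succ

/-- For `X ∼ Bin(m,p)` with `m ≥ 1` and `p ∈ (0,1]`,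
`E[1/(1+X)] = (1 − (1−p)^{m+1})/((m+1)p)`, and in particular `E[1/(1+X)] ≤ 1/(mp)`. -/
theorem stmt6 (m : ℕ) (hm : 1 ≤ m) (p : ℝ) (hp : 0 < p) (hp1 : p ≤ 1) :
    (∑ k ∈ Finset.range (m + 1),
        (Nat.choose m k : ℝ) * p ^ k * (1 - p) ^ (m - k) * (1 / (1 + (k : ℝ))))
      = (1 - (1 - p) ^ (m + 1)) / (((m : ℝ) + 1) * p) ∧
    (∑ k ∈ Finset.range (m + 1),
        (Nat.choose m k : ℝ) * p ^ k * (1 - p) ^ (m - k) * (1 / (1 + (k : ℝ))))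
      ≤ 1 / ((m : ℝ) * p) := by
  have closed_form := eq_div_of_mul_eq (by positivity)
    ((mul_comm _ _).trans (succ_mul_sum_binomial_mul_one_div m p))
  refine ⟨closed_form, closed_form.trans_le ?_⟩
  have hm' : (0 : ℝ) < m := by exact_mod_cast hm
  have hq : 0 ≤ (1 - p) ^ (m + 1) := pow_nonneg (sub_nonneg.mpr hp1) _
  gcongr <;> linarith
end
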